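/- Let p be a prime with p ≡ 11 or 19 (mod 20). Then there is exactly one index n with 1 ≤ n ≤ π(p) and p ∣ F_n, where F_n is the n-th Fibonacci number and π(p) is the Pisano period of p; that is, the Pisano period of p contains exactly one zero. -/

import Mathlib

/-- The Pisano period `π(m)`: the least positive `n` with `F_n ≡ 0 (mod m)`
and `F_{n+1} ≡ 1 (mod m)`, i.e. the period of the Fibonacci sequence mod `m`. -/
noncomputable def pisano (m : ℕ) : ℕ :=
  sInf {n : ℕ | 0 < n ∧ (Nat.fib n : ZMod m) = 0 ∧ (Nat.fib (n + 1) : ZMod m) = 1}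

theorem fib_pow_root {R : Type*} [CommRing R] (x : R) (hx : x ^ 2 = x + 1) (n : ℕ) :
    x ^ n = (Nat.fib n : R) * x + ((Nat.fib (n + 1) : R) - (Nat.fib n : R)) := by
  induction n with
  | zero => simp
  | succ k ih =>
    rw [pow_succ, ih, Nat.fib_add_two]
    push_cast
    linear_combination (Nat.fib k : R) * hx

/-- for a prime `p ≡ 11, 19 (mod 20)`, there is exactly one
index `n` with `1 ≤ n ≤ π(p)` and `p ∣ F_n`: the Pisano period of `p`
contains exactly one zero. -/
theorem pisano_period_one_zero (p : ℕ) (hp : p.Prime)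
    (h20 : p % 20 = 11 ∨ p % 20 = 19) :
    ((Finset.Icc 1 (pisano p)).filter fun n => p ∣ Nat.fib n).card = 1 := by
  haveI : Fact p.Prime := ⟨hp⟩
  haveI : Fact (Nat.Prime 5) := ⟨by norm_num⟩
  have h2 : (2 : ZMod p) ≠ 0 := by
    intro h
    have : p ∣ 2 := (ZMod.natCast_eq_zero_iff 2 p).1 (by exact_mod_cast h)
    have := Nat.le_of_dvd (by norm_num) this
    omega
  have h5 : (5 : ZMod p) ≠ 0 := by
    intro h
    have : p ∣ 5 := (ZMod.natCast_eq_zero_iff 5 p).1 (by exact_mod_cast h)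
    have := Nat.le_of_dvd (by norm_num) this
    omega
  have hneg : ¬ IsSquare (-1 : ZMod p) := by
    rw [ZMod.exists_sq_eq_neg_one_iff]
    omega
  have hsq : IsSquare ((5 : ℕ) : ZMod p) := by
    rw [← ZMod.exists_sq_eq_prime_iff_of_mod_four_eq_one (p := 5) (q := p) (by norm_num) (by omega)]
    have h : p % 5 = 1 ∨ p % 5 = 4 := by omega
    rw [← ZMod.natCast_mod p 5]
    rcases h with h | h <;> rw [h]
    · exact ⟨1, by norm_num⟩
    · exact ⟨2, by norm_num⟩
  obtain ⟨s, hs⟩ := hsq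
  push_cast at hs
  have hs0 : s ≠ 0 := by
    rintro rfl
    exact h5 (by simpa using hs)
  obtain ⟨t, ht⟩ : ∃ t : ZMod p, 2 * t = 1 := ⟨2⁻¹, mul_inv_cancel₀ h2⟩
  obtain ⟨a, ha⟩ : ∃ a, a = (1 + s) * t := ⟨_, rfl⟩
  obtain ⟨b, hb⟩ : ∃ b, b = (1 - s) * t := ⟨_, rfl⟩
  have hsum : a + b = 1 := by rw [ha, hb]; linear_combination ht
  have hdiff : a - b = s := by rw [ha, hb]; linear_combination s * ht
  have hprod : a * b = -1 := by
    rw [ha, hb]; linear_combination t ^ 2 * hs - (2 * t + 1) * ht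
  have ha2 : a ^ 2 = a + 1 := by linear_combination a * hsum - hprod
  have hb2 : b ^ 2 = b + 1 := by linear_combination b * hsum - hprod
  have key : ∀ n, (Nat.fib n : ZMod p) = 0 → (Nat.fib (n + 1) : ZMod p) = 1 := by
    intro n hn
    have e1 := fib_pow_root a ha2 n
    have e2 := fib_pow_root b hb2 n
    rw [hn] at e1 e2
    simp only [zero_mul, zero_add, sub_zero] at e1 e2
    have e3 : a ^ n * b ^ n = (-1) ^ n := by rw [← mul_pow, hprod]
    rcases Nat.even_or_odd n with he | ho
    · rw [e1, e2, he.neg_one_pow] at e3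
      rcases mul_self_eq_one_iff.1 e3 with h | h
      · exact h
      · obtain ⟨m, rfl⟩ := he
        exact absurd ⟨a ^ m, by rw [← h, ← e1, pow_add]⟩ hneg
    · rw [e1, e2, ho.neg_one_pow] at e3
      exact absurd ⟨_, e3.symm⟩ hneg
  have hne : {n : ℕ | 0 < n ∧ (Nat.fib n : ZMod p) = 0 ∧
      (Nat.fib (n + 1) : ZMod p) = 1}.Nonempty := by
    have hz : (Nat.fib (p - 1) : ZMod p) = 0 := by
      have a0 : a ≠ 0 := by rintro rfl; simp at hprod
      have b0 : b ≠ 0 := by rintro rfl; simp at hprod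
      have e1 := fib_pow_root a ha2 (p - 1)
      have e2 := fib_pow_root b hb2 (p - 1)
      rw [ZMod.pow_card_sub_one_eq_one a0] at e1
      rw [ZMod.pow_card_sub_one_eq_one b0] at e2
      have : (Nat.fib (p - 1) : ZMod p) * s = 0 := by
        rw [← hdiff]; linear_combination e2 - e1
      exact (mul_eq_zero.1 this).resolve_right hs0
    exact ⟨p - 1, by have := hp.two_le; omega, hz, key _ hz⟩
  have hmem := Nat.sInf_mem hne
  rw [Finset.card_eq_one]
  refine ⟨pisano p, ?_⟩
  ext n
  simp only [Finset.mem_filter, Finset.mem_Icc, Finset.mem_singleton]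
  constructor
  · rintro ⟨⟨h1, hle⟩, hd⟩
    have hz := (ZMod.natCast_eq_zero_iff _ p).2 hd
    exact le_antisymm hle (Nat.sInf_le ⟨h1, hz, key n hz⟩)
  · rintro rfl
    exact ⟨⟨hmem.1, le_rfl⟩, (ZMod.natCast_eq_zero_iff _ p).1 hmem.2.1⟩
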